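/- arXiv:2511.19486 — 8 statements merged into one kernel-verified Lean document; each statement's English description precedes it below -/
import Mathlib

section
/- Let a > 0, α > 0, b ≥ 0 and n > 0 be real numbers. Then the equation α·a·n·s^(−α−1) − (α+1)·a·s^(−α) − b = 0 has a unique solution s* in the open interval (0, n), and this s* is the unique minimizer over (0, n) of the function V(s) = (a·s^(−α) + b)/(n − s). -/
/-- Strict Bernoulli inequality for negative exponents. -/
theorem one_sub_mul_lt_rpow_neg {α u : ℝ} (hα : 0 < α) (hu : 0 < u) (hu1 : u ≠ 1) :
    1 - α * (u - 1) < u ^ (-α) := by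
  have hlog : Real.log u < u - 1 := Real.log_lt_sub_one_of_pos hu hu1
  have hexp := Real.add_one_le_exp (Real.log u * -α)
  rw [Real.rpow_def_of_pos hu]
  nlinarith

/-- The graph of `s ↦ s ^ (-α)` lies strictly above its tangent lines. -/
theorem tangent_lt_rpow_neg {α s t : ℝ} (hα : 0 < α) (hs : 0 < s) (ht : 0 < t) (hts : t ≠ s) :
    s ^ (-α) - α * s ^ (-α - 1) * (t - s) < t ^ (-α) := by
  have h := one_sub_mul_lt_rpow_neg hα (div_pos ht hs)
    (fun h => hts ((div_eq_one_iff_eq hs.ne').1 h))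
  rw [Real.div_rpow ht.le hs.le, lt_div_iff₀ (Real.rpow_pos_of_pos hs _)] at h
  rw [Real.rpow_sub_one hs.ne']
  calc s ^ (-α) - α * (s ^ (-α) / s) * (t - s)
      = (1 - α * (t / s - 1)) * s ^ (-α) := by
        have := hs.ne'
        generalize s ^ (-α) = x
        field_simp
    _ < t ^ (-α) := h

/-- A solution of the first-order condition is a strict minimizer of `V`. -/
theorem variance_lt_of_first_order {a α b n s t : ℝ} (ha : 0 < a) (hα : 0 < α)
    (hs : s ∈ Set.Ioo (0 : ℝ) n) (ht : t ∈ Set.Ioo (0 : ℝ) n) (hts : t ≠ s)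
    (hF : α * a * n * s ^ (-α - 1) - (α + 1) * a * s ^ (-α) - b = 0) :
    (a * s ^ (-α) + b) / (n - s) < (a * t ^ (-α) + b) / (n - t) := by
  have hpow : s ^ (-α) = s ^ (-α - 1) * s := by
    rw [Real.rpow_sub_one hs.1.ne', div_mul_cancel₀ _ hs.1.ne']
  have hV : (a * s ^ (-α) + b) / (n - s) = α * a * s ^ (-α - 1) := by
    rw [div_eq_iff (sub_pos.2 hs.2).ne']
    rw [hpow] at hF ⊢
    linear_combination -hF
  have htan := mul_lt_mul_of_pos_left (tangent_lt_rpow_neg hα hs.1 ht.1 hts) ha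
  rw [hV, lt_div_iff₀ (sub_pos.2 ht.2)]
  rw [hpow] at hF htan
  linarith

/-- The first-order condition has a solution in `(0, n)`. -/
theorem exists_first_order {a α b n : ℝ} (ha : 0 < a) (hα : 0 < α) (hb : 0 ≤ b) (hn : 0 < n) :
    ∃ s ∈ Set.Ioo (0 : ℝ) n,
      α * a * n * s ^ (-α - 1) - (α + 1) * a * s ^ (-α) - b = 0 := by
  have hcont : ContinuousOn
      (fun s : ℝ => α * a * n - (α + 1) * a * s - b * s ^ (α + 1)) (Set.Icc 0 n) :=
    ((continuous_const.sub (continuous_const.mul continuous_id)).sub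
      (continuous_const.mul (Real.continuous_rpow_const (by positivity)))).continuousOn
  have hmem : (0 : ℝ) ∈ Set.Ioo
      (α * a * n - (α + 1) * a * n - b * n ^ (α + 1))
      (α * a * n - (α + 1) * a * 0 - b * 0 ^ (α + 1)) := by
    rw [Real.zero_rpow (by positivity)]
    have h₁ : 0 < a * n := by positivity
    have h₂ : 0 ≤ b * n ^ (α + 1) := by positivity
    have h₃ : 0 < α * a * n := by positivity
    constructor <;> linarith
  obtain ⟨s, hs, h⟩ := intermediate_value_Ioo' hn.le hcont hmem
  refine ⟨s, hs, ?_⟩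
  have hpow : s ^ (-α) = s ^ (-α - 1) * s := by
    rw [Real.rpow_sub_one hs.1.ne', div_mul_cancel₀ _ hs.1.ne']
  have hinv : s ^ (-α - 1) * s ^ (α + 1) = 1 := by
    rw [← Real.rpow_add hs.1, show -α - 1 + (α + 1) = 0 by ring, Real.rpow_zero]
  simp only at h
  rw [hpow]
  linear_combination s ^ (-α - 1) * h + b * hinv

/-- For `a > 0`, `α > 0`, `b ≥ 0`, `n > 0`, the first-order condition
`α·a·n·s^(−α−1) − (α+1)·a·s^(−α) − b = 0` has a unique solution `s*` in `(0, n)`, and this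
`s*` is the unique minimizer over `(0, n)` of `V(s) = (a·s^(−α) + b)/(n − s)`. -/
theorem stmt_0 (a α b n : ℝ) (ha : 0 < a) (hα : 0 < α) (hb : 0 ≤ b) (hn : 0 < n) :
    ∃ s ∈ Set.Ioo (0 : ℝ) n,
      (α * a * n * s ^ (-α - 1) - (α + 1) * a * s ^ (-α) - b = 0) ∧
      (∀ t ∈ Set.Ioo (0 : ℝ) n,
        α * a * n * t ^ (-α - 1) - (α + 1) * a * t ^ (-α) - b = 0 → t = s) ∧
      (∀ t ∈ Set.Ioo (0 : ℝ) n, t ≠ s →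
        (a * s ^ (-α) + b) / (n - s) < (a * t ^ (-α) + b) / (n - t)) := by
  obtain ⟨s, hs, hF⟩ := exists_first_order ha hα hb hn
  refine ⟨s, hs, hF, fun t ht hFt => ?_, fun t ht hts =>
    variance_lt_of_first_order ha hα hs ht hts hF⟩
  by_contra hts
  exact lt_asymm (variance_lt_of_first_order ha hα hs ht hts hF)
    (variance_lt_of_first_order ha hα ht hs (Ne.symm hts) hFt)
end

section
/- Fix α > 0, b ≥ 0 and n > 0, and for each a > 0 let s*(a) denote the unique root in (0, n) of F(s) = α·a·n·s^(−α−1) − (α+1)·a·s^(−α) − b. Then s*(a) is nondecreasing in a; moreover, if b > 0 then s*(a) is strictly increasing in a, i.e., for all 0 < a₁ < a₂ one has s*(a₁) < s*(a₂). -/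
/-- The equation `F s = 0`, factored as `a * (s ^ (-α - 1) * (α * n - (α + 1) * s)) = b`. -/
lemma mul_rpow_mul_eq_of_root {α a b n s : ℝ} (hs : 0 < s)
    (h : α * a * n * s ^ (-α - 1) - (α + 1) * a * s ^ (-α) - b = 0) :
    a * (s ^ (-α - 1) * (α * n - (α + 1) * s)) = b := by
  have hpow : s ^ (-α) = s ^ (-α - 1) * s := by
    rw [Real.rpow_sub_one hs.ne', div_mul_cancel₀ _ hs.ne']
  rw [hpow] at h
  linear_combination h

/-- `s ↦ s ^ (-α - 1) * (α * n - (α + 1) * s)` is strictly decreasing where it is nonnegative. -/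
lemma rpow_mul_lt_of_lt {α n s t : ℝ} (hα : 0 < α) (hs : 0 < s) (hst : s < t)
    (ht : 0 ≤ t ^ (-α - 1) * (α * n - (α + 1) * t)) :
    t ^ (-α - 1) * (α * n - (α + 1) * t) < s ^ (-α - 1) * (α * n - (α + 1) * s) := by
  have htpos : 0 < t ^ (-α - 1) := Real.rpow_pos_of_pos (hs.trans hst) _
  have hnonneg : 0 ≤ α * n - (α + 1) * t := nonneg_of_mul_nonneg_right ht htpos
  have hlt : α * n - (α + 1) * t < α * n - (α + 1) * s := by
    have := mul_lt_mul_of_pos_left hst (by linarith : 0 < α + 1)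
    linarith
  have hpow : t ^ (-α - 1) ≤ s ^ (-α - 1) :=
    Real.rpow_le_rpow_of_nonpos hs hst.le (by linarith)
  exact (mul_lt_mul_of_pos_left hlt htpos).trans_le
    (mul_le_mul_of_nonneg_right hpow (hnonneg.trans hlt.le))


/-- Fix `α > 0`, `b ≥ 0`, `n > 0`, and for each `a > 0` let `sstar a` be the
unique root in `(0, n)` of `F(s) = α·a·n·s^(−α−1) − (α+1)·a·s^(−α) − b`. Then `sstar` is
nondecreasing in `a`, and strictly increasing in `a` whenever `b > 0`. -/
theorem stmt_4 (α b n : ℝ) (hα : 0 < α) (hb : 0 ≤ b) (hn : 0 < n)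
    (sstar : ℝ → ℝ)
    (hroot : ∀ a : ℝ, 0 < a → sstar a ∈ Set.Ioo (0 : ℝ) n ∧
      α * a * n * (sstar a) ^ (-α - 1) - (α + 1) * a * (sstar a) ^ (-α) - b = 0) :
    (∀ a₁ a₂ : ℝ, 0 < a₁ → a₁ ≤ a₂ → sstar a₁ ≤ sstar a₂) ∧
    (0 < b → ∀ a₁ a₂ : ℝ, 0 < a₁ → a₁ < a₂ → sstar a₁ < sstar a₂) := by
  have hfac (a : ℝ) (ha : 0 < a) := mul_rpow_mul_eq_of_root (hroot a ha).1.1 (hroot a ha).2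
  have hnonneg (a : ℝ) (ha : 0 < a) :
      0 ≤ sstar a ^ (-α - 1) * (α * n - (α + 1) * sstar a) :=
    nonneg_of_mul_nonneg_right ((hfac a ha).symm ▸ hb) ha
  have hmono (a₁ a₂ : ℝ) (h₁ : 0 < a₁) (h₁₂ : a₁ ≤ a₂) : sstar a₁ ≤ sstar a₂ := by
    by_contra! hlt
    have h₂ := h₁.trans_le h₁₂
    have hG := rpow_mul_lt_of_lt hα (hroot a₂ h₂).1.1 hlt (hnonneg a₁ h₁)
    have hle := mul_le_mul_of_nonneg_right h₁₂ (hnonneg a₁ h₁)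
    have hlt' := mul_lt_mul_of_pos_left hG h₂
    linarith [hfac a₁ h₁, hfac a₂ h₂]
  refine ⟨hmono, fun hbpos a₁ a₂ h₁ h₁₂ => (hmono a₁ a₂ h₁ h₁₂.le).lt_of_ne fun heq => ?_⟩
  have e₁ := hfac a₁ h₁
  have e₂ := hfac a₂ (h₁.trans h₁₂)
  rw [← heq] at e₂
  have hG := pos_of_mul_pos_right (e₁.symm ▸ hbpos) h₁.le
  have hlt := mul_lt_mul_of_pos_right h₁₂ hG
  linarith
end

section
/- Fix a > 0, α > 0 and n > 0, and for each b ≥ 0 let s*(b) denote the unique root in (0, n) of F(s) = α·a·n·s^(−α−1) − (α+1)·a·s^(−α) − b. Then s*(b) is strictly decreasing in b, i.e., for all 0 ≤ b₁ < b₂ one has s*(b₁) > s*(b₂). -/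
/-- Fix `a > 0`, `α > 0`, `n > 0`, and for each `b ≥ 0` let `sstar b` be the
unique root in `(0, n)` of `F(s) = α·a·n·s^(−α−1) − (α+1)·a·s^(−α) − b`. Then `sstar` is
strictly decreasing in `b`: for all `0 ≤ b₁ < b₂`, `sstar b₁ > sstar b₂`. -/
theorem stmt_5 (a α n : ℝ) (ha : 0 < a) (hα : 0 < α) (hn : 0 < n)
    (sstar : ℝ → ℝ)
    (hroot : ∀ b : ℝ, 0 ≤ b → sstar b ∈ Set.Ioo (0 : ℝ) n ∧
      α * a * n * (sstar b) ^ (-α - 1) - (α + 1) * a * (sstar b) ^ (-α) - b = 0) :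
    ∀ b₁ b₂ : ℝ, 0 ≤ b₁ → b₁ < b₂ → sstar b₂ < sstar b₁ := by
  intro b₁ b₂ hb₁ hb
  obtain ⟨⟨hs₁, -⟩, h₁⟩ := hroot b₁ hb₁
  obtain ⟨⟨hs₂, -⟩, h₂⟩ := hroot b₂ (hb₁.trans hb.le)
  have factor : ∀ s : ℝ, 0 < s → α * a * n * s ^ (-α - 1) - (α + 1) * a * s ^ (-α)
      = s ^ (-α - 1) * (a * (α * n - (α + 1) * s)) := by
    intro s hs
    have hpow : s ^ (-α) = s ^ (-α - 1) * s := by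
      rw [← Real.rpow_add_one hs.ne', sub_add_cancel]
    rw [hpow]
    ring
  rw [factor _ hs₁] at h₁
  rw [factor _ hs₂] at h₂
  by_contra! hle
  have hpow : sstar b₂ ^ (-α - 1) ≤ sstar b₁ ^ (-α - 1) :=
    Real.rpow_le_rpow_of_nonpos hs₁ hle (by linarith)
  have hlin : a * (α * n - (α + 1) * sstar b₂) ≤ a * (α * n - (α + 1) * sstar b₁) := by
    gcongr
  have hpos : 0 < a * (α * n - (α + 1) * sstar b₂) :=
    pos_of_mul_pos_right (by linarith) (Real.rpow_nonneg hs₂.le (-α - 1))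
  have := mul_le_mul hpow hlin hpos.le (Real.rpow_nonneg hs₁.le _)
  linarith
end

section
/- Fix a > 0, α > 0 and b ≥ 0, and for each n > 0 let s*(n) denote the unique root in (0, n) of F(s) = α·a·n·s^(−α−1) − (α+1)·a·s^(−α) − b. Then s*(n) is strictly increasing in n, i.e., for all 0 < n₁ < n₂ one has s*(n₁) < s*(n₂). -/
/-- Fix `a > 0`, `α > 0`, `b ≥ 0`, and for each `n > 0` let `sstar n` be the
unique root in `(0, n)` of `F(s) = α·a·n·s^(−α−1) − (α+1)·a·s^(−α) − b`. Then `sstar` is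
strictly increasing in `n`: for all `0 < n₁ < n₂`, `sstar n₁ < sstar n₂`. -/
theorem stmt_6 (a α b : ℝ) (ha : 0 < a) (hα : 0 < α) (hb : 0 ≤ b)
    (sstar : ℝ → ℝ)
    (hroot : ∀ n : ℝ, 0 < n → sstar n ∈ Set.Ioo (0 : ℝ) n ∧
      α * a * n * (sstar n) ^ (-α - 1) - (α + 1) * a * (sstar n) ^ (-α) - b = 0) :
    ∀ n₁ n₂ : ℝ, 0 < n₁ → n₁ < n₂ → sstar n₁ < sstar n₂ := by
  intro n₁ n₂ hn₁ hlt
  obtain ⟨⟨hs₁, -⟩, h₁⟩ := hroot n₁ hn₁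
  obtain ⟨⟨hs₂, -⟩, h₂⟩ := hroot n₂ (hn₁.trans hlt)
  by_contra! hle
  have hpow : ∀ s : ℝ, 0 < s → s ^ (-α) = s ^ (-α - 1) * s := fun s hs ↦ by
    rw [← Real.rpow_add_one hs.ne', sub_add_cancel]
  rw [hpow _ hs₁] at h₁
  rw [hpow _ hs₂] at h₂
  have hp₁ : 0 < sstar n₁ ^ (-α - 1) := Real.rpow_pos_of_pos hs₁ _
  have hp : sstar n₁ ^ (-α - 1) ≤ sstar n₂ ^ (-α - 1) :=
    Real.rpow_le_rpow_of_nonpos hs₂ hle (by linarith)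
  generalize sstar n₁ ^ (-α - 1) = p₁ at *
  generalize sstar n₂ ^ (-α - 1) = p₂ at *
  have e₁ : p₁ * (α * a * n₁ - (α + 1) * a * sstar n₁) = b := by linarith
  have e₂ : p₂ * (α * a * n₂ - (α + 1) * a * sstar n₂) = b := by linarith
  have hX₁ : 0 ≤ α * a * n₁ - (α + 1) * a * sstar n₁ :=
    nonneg_of_mul_nonneg_right (e₁ ▸ hb) hp₁
  have hX : α * a * n₁ - (α + 1) * a * sstar n₁ < α * a * n₂ - (α + 1) * a * sstar n₂ := by
    have hn : α * a * n₁ < α * a * n₂ := by gcongr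
    have hs : (α + 1) * a * sstar n₂ ≤ (α + 1) * a * sstar n₁ := by gcongr
    linarith
  have hlt_b := (mul_le_mul_of_nonneg_right hp hX₁).trans_lt
    (mul_lt_mul_of_pos_left hX (hp₁.trans_le hp))
  rw [e₁, e₂] at hlt_b
  exact hlt_b.false
end

section
/- Fix a > 0, α > 0 and b ≥ 0, and for each n > 0 let s*(n) denote the unique root in (0, n) of F(s) = α·a·n·s^(−α−1) − (α+1)·a·s^(−α) − b. Then the map n ↦ s*(n) is differentiable on (0, ∞) with derivative d s*/d n = a·α / ((a + b·s*(n)^α)·(α+1)); in particular 0 < d s*/d n ≤ α/(α+1). -/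
open Set Topology

/-- A root of `F` determines `n` as an explicit function of the root. -/
lemma eq_of_root {a α b n s : ℝ} (ha : 0 < a) (hα : 0 < α) (hs : 0 < s)
    (h : α * a * n * s ^ (-α - 1) - (α + 1) * a * s ^ (-α) - b = 0) :
    (α + 1) / α * s + b / (a * α) * s ^ (α + 1) = n := by
  have hp : 0 < s ^ α := Real.rpow_pos_of_pos hs α
  rw [Real.rpow_sub_one hs.ne', Real.rpow_neg hs.le] at h
  rw [Real.rpow_add_one hs.ne']
  field_simp at h ⊢
  linarith

lemma le_add_dist_of_eq {a α b m n s t : ℝ} (ha : 0 < a) (hα : 0 < α) (hb : 0 ≤ b) (ht : 0 < t)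
    (hm : (α + 1) / α * s + b / (a * α) * s ^ (α + 1) = m)
    (hn : (α + 1) / α * t + b / (a * α) * t ^ (α + 1) = n) :
    s ≤ t + dist m n := by
  rcases le_or_gt s t with hst | hst
  · linarith [dist_nonneg (x := m) (y := n)]
  · have hpow : b / (a * α) * t ^ (α + 1) ≤ b / (a * α) * s ^ (α + 1) := by gcongr
    have hcoef : 1 ≤ (α + 1) / α := by rw [one_le_div hα]; linarith
    have hlin : s - t ≤ (α + 1) / α * (s - t) := le_mul_of_one_le_left (by linarith) hcoef
    have hdist : m - n ≤ dist m n := le_abs_self _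
    linarith

/-- Fix `a > 0`, `α > 0`, `b ≥ 0`, and for each `n > 0` let `sstar n` be the
unique root in `(0, n)` of `F(s) = α·a·n·s^(−α−1) − (α+1)·a·s^(−α) − b`. Then `n ↦ sstar n`
is differentiable on `(0, ∞)` with derivative `a·α/((a + b·(sstar n)^α)·(α+1))`, which lies in
`(0, α/(α+1)]`. -/
theorem stmt_8 (a α b : ℝ) (ha : 0 < a) (hα : 0 < α) (hb : 0 ≤ b)
    (sstar : ℝ → ℝ)
    (hroot : ∀ n : ℝ, 0 < n → sstar n ∈ Set.Ioo (0 : ℝ) n ∧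
      α * a * n * (sstar n) ^ (-α - 1) - (α + 1) * a * (sstar n) ^ (-α) - b = 0) :
    ∀ n : ℝ, 0 < n →
      HasDerivAt sstar (a * α / ((a + b * (sstar n) ^ α) * (α + 1))) n ∧
      0 < a * α / ((a + b * (sstar n) ^ α) * (α + 1)) ∧
      a * α / ((a + b * (sstar n) ^ α) * (α + 1)) ≤ α / (α + 1) := by
  have hpos : ∀ n, 0 < n → 0 < sstar n := fun n hn => (hroot n hn).1.1
  have hinv : ∀ n, 0 < n →
      (α + 1) / α * sstar n + b / (a * α) * sstar n ^ (α + 1) = n := fun n hn =>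
    eq_of_root ha hα (hpos n hn) (hroot n hn).2
  have hlip : LipschitzOnWith 1 sstar (Ioi 0) := LipschitzOnWith.of_le_add fun m hm n hn =>
    le_add_dist_of_eq ha hα hb (hpos n hn) (hinv m hm) (hinv n hn)
  intro n hn
  have hs := hpos n hn
  have hp : 0 < sstar n ^ α := Real.rpow_pos_of_pos hs α
  have hden : 0 < a + b * sstar n ^ α := by positivity
  refine ⟨?_, by positivity, ?_⟩
  · have hderiv : HasDerivAt (fun s : ℝ => (α + 1) / α * s + b / (a * α) * s ^ (α + 1))
        (a * α / ((a + b * sstar n ^ α) * (α + 1)))⁻¹ (sstar n) := by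
      refine (((hasDerivAt_id (sstar n)).const_mul ((α + 1) / α)).add
        ((Real.hasDerivAt_rpow_const (p := α + 1) (Or.inl hs.ne')).const_mul
          (b / (a * α)))).congr_deriv ?_
      rw [add_sub_cancel_right]
      field_simp
    have hcont : ContinuousAt sstar n := hlip.continuousOn.continuousAt (Ioi_mem_nhds hn)
    have hlocal := HasDerivAt.of_local_left_inverse hcont hderiv (by positivity)
      (Filter.eventually_of_mem (Ioi_mem_nhds hn) hinv)
    rwa [inv_inv] at hlocal
  · rw [div_le_div_iff₀ (by positivity) (by positivity)]
    have : 0 ≤ b * sstar n ^ α * (α * (α + 1)) := by positivity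
    linarith
end

section
/- Fix a > 0, α > 0 and b ≥ 0, and for each n > 0 let s*(n) denote the unique root in (0, n) of F(s) = α·a·n·s^(−α−1) − (α+1)·a·s^(−α) − b. Then n·(d s*/d n) − s*(n) = −α·b·(s*(n))^(α+1) / ((a + b·(s*(n))^α)·(α+1)), and consequently d/dn (s*(n)/n) = −α·b·(s*(n))^(α+1) / (n²·(a + b·(s*(n))^α)·(α+1)); in particular, if b > 0 then the fraction s*(n)/n is strictly decreasing in n. -/
open Set Filter Topology

/-- The inverse map: `s` is a root of `F` for the parameter `n` exactly when `n` is this value. -/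
noncomputable def rootParameter (a α b s : ℝ) : ℝ :=
  (α + 1) / α * s + b / (a * α) * s ^ (α + 1)

theorem rootParameter_eq_of_root {a α b n s : ℝ} (ha : 0 < a) (hα : 0 < α) (hs : 0 < s)
    (h : α * a * n * s ^ (-α - 1) - (α + 1) * a * s ^ (-α) - b = 0) :
    rootParameter a α b s = n := by
  have hp : 0 < s ^ α := Real.rpow_pos_of_pos hs α
  rw [Real.rpow_sub_one hs.ne', Real.rpow_neg hs.le] at h
  rw [rootParameter, Real.rpow_add_one hs.ne']
  field_simp at h ⊢
  linarith

theorem strictMonoOn_rootParameter {a α b : ℝ} (ha : 0 < a) (hα : 0 < α) (hb : 0 ≤ b) :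
    StrictMonoOn (rootParameter a α b) (Ioi 0) := by
  intro x hx y _ hxy
  have hx' : 0 ≤ x := le_of_lt hx
  have hpow : x ^ (α + 1) ≤ y ^ (α + 1) := Real.rpow_le_rpow hx' hxy.le (by linarith)
  exact add_lt_add_of_lt_of_le (mul_lt_mul_of_pos_left hxy (by positivity))
    (mul_le_mul_of_nonneg_left hpow (by positivity))

theorem rootParameter_pos {a α b s : ℝ} (ha : 0 < a) (hα : 0 < α) (hb : 0 ≤ b) (hs : 0 < s) :
    0 < rootParameter a α b s := by
  unfold rootParameter
  positivity

theorem hasDerivAt_rootParameter {a α b s : ℝ} (ha : 0 < a) (hα : 0 < α) (hs : 0 < s) :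
    HasDerivAt (rootParameter a α b) ((α + 1) * (a + b * s ^ α) / (a * α)) s := by
  have h := ((hasDerivAt_id s).const_mul ((α + 1) / α)).add
    ((Real.hasDerivAt_rpow_const (p := α + 1) (Or.inl hs.ne')).const_mul (b / (a * α)))
  refine h.congr_deriv ?_
  rw [add_sub_cancel_right]
  field_simp

/-- A positive right inverse of `rootParameter` on `(0, ∞)` is differentiable there. -/
theorem hasDerivAt_of_rootParameter_rightInverse {a α b : ℝ} (ha : 0 < a) (hα : 0 < α)
    (hb : 0 ≤ b) {f : ℝ → ℝ} (hpos : ∀ n, 0 < n → 0 < f n)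
    (hinv : ∀ n, 0 < n → rootParameter a α b (f n) = n) {n : ℝ} (hn : 0 < n) :
    HasDerivAt f ((α + 1) * (a + b * f n ^ α) / (a * α))⁻¹ n := by
  have hg := strictMonoOn_rootParameter ha hα hb
  have hmono : StrictMonoOn f (Ioi 0) := by
    intro x hx y hy hxy
    rw [← hg.lt_iff_lt (hpos x hx) (hpos y hy), hinv x hx, hinv y hy]
    exact hxy
  have himage : Ioi 0 ⊆ f '' Ioi 0 := by
    intro s hs
    have hp := rootParameter_pos ha hα hb hs
    exact ⟨_, hp, hg.injOn (hpos _ hp) hs (hinv _ hp)⟩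
  have hcont : ContinuousAt f n := hmono.continuousAt_of_image_mem_nhds
    (Ioi_mem_nhds hn) (mem_of_superset (Ioi_mem_nhds (hpos n hn)) himage)
  have hfn := hpos n hn
  exact (hasDerivAt_rootParameter ha hα hfn).of_local_left_inverse hcont (by positivity)
    (by filter_upwards [Ioi_mem_nhds hn] with y hy using hinv y hy)

/-- Fix `a > 0`, `α > 0`, `b ≥ 0`, and for each `n > 0` let `sstar n` be the
unique root in `(0, n)` of `F(s) = α·a·n·s^(−α−1) − (α+1)·a·s^(−α) − b`. Then
`n·(sstar)′(n) − sstar n = −α·b·(sstar n)^(α+1)/((a + b·(sstar n)^α)·(α+1))`, hence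
`d/dn (sstar n/n) = −α·b·(sstar n)^(α+1)/(n²·(a + b·(sstar n)^α)·(α+1))`; in particular, if
`b > 0` then `n ↦ sstar n/n` is strictly decreasing on `(0, ∞)`. -/
theorem stmt_9 (a α b : ℝ) (ha : 0 < a) (hα : 0 < α) (hb : 0 ≤ b)
    (sstar : ℝ → ℝ)
    (hroot : ∀ n : ℝ, 0 < n → sstar n ∈ Set.Ioo (0 : ℝ) n ∧
      α * a * n * (sstar n) ^ (-α - 1) - (α + 1) * a * (sstar n) ^ (-α) - b = 0) :
    (∀ n : ℝ, 0 < n →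
      n * deriv sstar n - sstar n =
        -(α * b * (sstar n) ^ (α + 1)) / ((a + b * (sstar n) ^ α) * (α + 1)) ∧
      deriv (fun n : ℝ => sstar n / n) n =
        -(α * b * (sstar n) ^ (α + 1)) / (n ^ 2 * (a + b * (sstar n) ^ α) * (α + 1))) ∧
    (0 < b → StrictAntiOn (fun n : ℝ => sstar n / n) (Set.Ioi 0)) := by
  have hpos : ∀ n, 0 < n → 0 < sstar n := fun n hn => (hroot n hn).1.1
  have hinv : ∀ n, 0 < n → rootParameter a α b (sstar n) = n := fun n hn =>
    rootParameter_eq_of_root ha hα (hpos n hn) (hroot n hn).2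
  have hderiv : ∀ n, 0 < n → HasDerivAt sstar _ n := fun n hn =>
    hasDerivAt_of_rootParameter_rightInverse ha hα hb hpos hinv hn
  have hmain : ∀ n : ℝ, 0 < n →
      n * deriv sstar n - sstar n =
        -(α * b * (sstar n) ^ (α + 1)) / ((a + b * (sstar n) ^ α) * (α + 1)) := by
    intro n hn
    have hs := hpos n hn
    have hD : 0 < a + b * sstar n ^ α := by positivity
    have hi := hinv n hn
    rw [rootParameter, Real.rpow_add_one hs.ne'] at hi
    rw [(hderiv n hn).deriv, Real.rpow_add_one hs.ne']
    field_simp at hi ⊢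
    linarith
  have hquot : ∀ n : ℝ, 0 < n →
      deriv (fun n : ℝ => sstar n / n) n =
        -(α * b * (sstar n) ^ (α + 1)) / (n ^ 2 * (a + b * (sstar n) ^ α) * (α + 1)) := by
    intro n hn
    have h := (hderiv n hn).differentiableAt.hasDerivAt.div (hasDerivAt_id n) hn.ne'
    refine h.deriv.trans ?_
    rw [id, mul_one, mul_comm (deriv sstar n) n, hmain n hn, div_div]
    congr 1
    ring
  refine ⟨fun n hn => ⟨hmain n hn, hquot n hn⟩, fun hb' => ?_⟩
  refine strictAntiOn_of_deriv_neg (convex_Ioi 0) ?_ ?_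
  · exact fun n hn => ((hderiv n hn).continuousAt.div continuousAt_id
      (ne_of_gt hn)).continuousWithinAt
  · intro n hn
    rw [interior_Ioi] at hn
    have hn' : 0 < n := hn
    have hs := hpos n hn'
    rw [hquot n hn', neg_div, neg_lt_zero]
    positivity
end

section
/- Fix a > 0, α > 0 and b > 0, and for each n > 0 let s*(n) denote the unique root in (0, n) of F(s) = α·a·n·s^(−α−1) − (α+1)·a·s^(−α) − b. Then the fine-tuning fraction vanishes asymptotically: lim_{n → ∞} s*(n)/n = 0. -/
/-- Fix `a > 0`, `α > 0`, `b > 0`, and for each `n > 0` let `sstar n` be the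
unique root in `(0, n)` of `F(s) = α·a·n·s^(−α−1) − (α+1)·a·s^(−α) − b`. Then the fine-tuning
fraction vanishes asymptotically: `sstar n / n → 0` as `n → ∞`. -/
theorem stmt_10 (a α b : ℝ) (ha : 0 < a) (hα : 0 < α) (hb : 0 < b)
    (sstar : ℝ → ℝ)
    (hroot : ∀ n : ℝ, 0 < n → sstar n ∈ Set.Ioo (0 : ℝ) n ∧
      α * a * n * (sstar n) ^ (-α - 1) - (α + 1) * a * (sstar n) ^ (-α) - b = 0) :
    Filter.Tendsto (fun n : ℝ => sstar n / n) Filter.atTop (nhds 0) := by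
  have hα1 : 0 < α + 1 := by linarith
  set p : ℝ := (α + 1)⁻¹
  have hp1 : p < 1 := inv_lt_one_of_one_lt₀ (by linarith)
  have hC : 0 ≤ α * a / b := by positivity
  have hlim : Filter.Tendsto (fun n : ℝ => (α * a / b) ^ p * n ^ (-(1 - p)))
      Filter.atTop (nhds 0) := by
    simpa using (tendsto_rpow_neg_atTop (sub_pos.2 hp1)).const_mul ((α * a / b) ^ p)
  refine squeeze_zero' ?_ ?_ hlim
  · filter_upwards [Filter.eventually_gt_atTop 0] with n hn
    exact div_nonneg (hroot n hn).1.1.le hn.le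
  · filter_upwards [Filter.eventually_gt_atTop 0] with n hn
    obtain ⟨⟨hs, -⟩, hF⟩ := hroot n hn
    have hS : 0 < sstar n ^ (α + 1) := Real.rpow_pos_of_pos hs _
    have hpow : sstar n ^ (α + 1) ≤ α * a / b * n := by
      have hnonneg : 0 ≤ (α + 1) * a * sstar n ^ (-α) := by positivity
      rw [show -α - 1 = -(α + 1) by ring, Real.rpow_neg hs.le (α + 1)] at hF
      have hle : b ≤ α * a * n / sstar n ^ (α + 1) := by
        rw [div_eq_mul_inv]
        linarith
      rw [le_div_iff₀ hS] at hle
      rw [div_mul_eq_mul_div, le_div_iff₀ hb]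
      linarith
    have hsle : sstar n ≤ (α * a / b) ^ p * n ^ p := by
      rw [← Real.mul_rpow hC hn.le]
      calc sstar n = (sstar n ^ (α + 1)) ^ p := (Real.rpow_rpow_inv hs.le hα1.ne').symm
        _ ≤ (α * a / b * n) ^ p :=
          Real.rpow_le_rpow hS.le hpow (inv_nonneg.2 hα1.le)
    rw [div_le_iff₀ hn, mul_assoc, ← Real.rpow_add_one hn.ne',
      show -(1 - p) + 1 = p by ring]
    exact hsle
end

section
/- Let a > 0, α > 0, b ≥ 0, n > 0 and σ² > 0. There exists s ∈ (0, n) such that (a·s^(−α) + b)/(n − s) < σ²/n if and only if b/σ² < 1 − (1 + 1/α)·(a·α·n^(−α)/σ²)^{1/(α+1)}. -/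
/-- Tangent-line bound at `1` for a negative power. -/
theorem one_sub_mul_le_rpow_neg {α u : ℝ} (hα : 0 ≤ α) (hu : 0 < u) :
    1 - α * (u - 1) ≤ u ^ (-α) := by
  rw [Real.rpow_def_of_pos hu]
  have h₁ := Real.add_one_le_exp (Real.log u * -α)
  have h₂ := mul_le_mul_of_nonneg_left (Real.log_le_sub_one_of_pos hu) hα
  linarith

/-- The scaling law expressed relative to the minimizer `n * K`. -/
theorem mul_rpow_neg_eq_of_rpow_eq {a α n σ2 K s : ℝ} (hα : 0 < α) (hn : 0 < n) (hσ : 0 < σ2)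
    (hK : 0 < K) (hs : 0 < s) (h : K ^ (α + 1) = a * α * n ^ (-α) / σ2) :
    a * s ^ (-α) = σ2 * (K / α) * (s / (n * K)) ^ (-α) := by
  rw [Real.div_rpow hs.le (by positivity), Real.mul_rpow hn.le hK.le]
  have hKα : K ^ (α + 1) * K ^ (-α) = K := by
    rw [← Real.rpow_add hK]
    simp
  have hn₀ : 0 < n ^ (-α) := by positivity
  have hK₀ : 0 < K ^ (-α) := by positivity
  nth_rewrite 1 [← hKα]
  rw [h]
  field_simp

/-- For `a > 0`, `α > 0`, `b ≥ 0`, `n > 0`, `σ² > 0`: there exists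
`s ∈ (0, n)` with `(a·s^(−α) + b)/(n − s) < σ²/n` if and only if
`b/σ² < 1 − (1 + 1/α)·(a·α·n^(−α)/σ²)^{1/(α+1)}`. -/
theorem stmt_15 (a α b n σ2 : ℝ) (ha : 0 < a) (hα : 0 < α) (hb : 0 ≤ b) (hn : 0 < n)
    (hσ : 0 < σ2) :
    (∃ s ∈ Set.Ioo (0 : ℝ) n, (a * s ^ (-α) + b) / (n - s) < σ2 / n) ↔
      b / σ2 < 1 - (1 + 1 / α) * (a * α * n ^ (-α) / σ2) ^ (1 / (α + 1)) := by
  have hc : 0 < a * α * n ^ (-α) / σ2 := by positivity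
  obtain ⟨K, hKdef⟩ : ∃ K, K = (a * α * n ^ (-α) / σ2) ^ (1 / (α + 1)) := ⟨_, rfl⟩
  have hK : 0 < K := hKdef ▸ Real.rpow_pos_of_pos hc _
  have hKpow : K ^ (α + 1) = a * α * n ^ (-α) / σ2 := by
    rw [hKdef, one_div, Real.rpow_inv_rpow hc.le (by positivity)]
  rw [← hKdef, div_lt_iff₀ hσ]
  constructor
  · rintro ⟨s, ⟨hs, hsn⟩, h⟩
    rw [div_lt_iff₀ (sub_pos.2 hsn), mul_rpow_neg_eq_of_rpow_eq hα hn hσ hK hs hKpow] at h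
    have hu : 0 < s / (n * K) := by positivity
    have hmul := mul_le_mul_of_nonneg_left (one_sub_mul_le_rpow_neg hα.le hu)
      (by positivity : 0 ≤ σ2 * (K / α))
    have h₁ : σ2 * (K / α) * (1 - α * (s / (n * K) - 1)) =
        σ2 * ((1 + 1 / α) * K) - σ2 * (s / n) := by
      field_simp
      ring
    have h₂ : σ2 / n * (n - s) = σ2 - σ2 * (s / n) := by
      field_simp
    linarith
  · intro h
    have hK₁ : K < 1 := by
      have h₁ : 0 < 1 - (1 + 1 / α) * K := pos_of_mul_pos_left (hb.trans_lt h) hσ.le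
      have h₂ : 0 < 1 / α * K := by positivity
      linarith
    have hnK : 0 < n * K := by positivity
    have hlt : n * K < n := mul_lt_of_lt_one_right hn hK₁
    refine ⟨n * K, ⟨hnK, hlt⟩, ?_⟩
    rw [div_lt_iff₀ (sub_pos.2 hlt), mul_rpow_neg_eq_of_rpow_eq hα hn hσ hK hnK hKpow,
      div_self hnK.ne', Real.one_rpow]
    have h₂ : σ2 / n * (n - n * K) = σ2 - σ2 * K := by
      field_simp
    have h₃ : K / α = 1 / α * K := by ring
    rw [h₂, h₃]
    linarith
end
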